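/- Let Π=(P,L) be a connected partial linear space satisfying conditions (a)–(e) of the Setting. If some connected component of the graph (P,⊥) has diameter 1 (i.e., any two of its points are ⊥), then every connected component of (P,⊥) has diameter 1. -/

import Mathlib

universe u

/-- A *partial linear space*: a set of points `P` together with a set `L` of
subsets of `P` of size at least `2` (the *lines*), such that two distinct
points lie on at most one common line. -/
structure PLS (P : Type u) where
  L : Set (Set P)
  nontrivial_lines : ∀ l ∈ L, Set.Nontrivial l
  unique_line : ∀ l ∈ L, ∀ m ∈ L, ∀ x y : P, x ≠ y →
    x ∈ l → y ∈ l → x ∈ m → y ∈ m → l = m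

namespace PLS

variable {P : Type u} (S : PLS P)

/-- `x ∼ y` : the points are distinct and lie on a common line. -/
def Collinear (x y : P) : Prop := x ≠ y ∧ ∃ l ∈ S.L, x ∈ l ∧ y ∈ l

/-- `x ⊥ y` : `x = y` or `x` and `y` are non-collinear. -/
def Perp (x y : P) : Prop := ¬ S.Collinear x y

/-- `x^⊥` : the set of points `y` with `x ⊥ y`. -/
def perpSet (x : P) : Set P := {y | S.Perp x y}

/-- Adjacency in the graph `(P, ⊥)` : distinct points with `x ⊥ y`. -/
def PerpAdj (x y : P) : Prop := x ≠ y ∧ S.Perp x y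

/-- `X^⊥` for a set `X` of points: points `⊥` to every point of `X`. -/
def setPerp (X : Set P) : Set P := {z | ∀ p ∈ X, S.Perp z p}

/-- `(xy)^{⊥⊥} = {z ∈ P : z ⊥ u for every u ∈ x^⊥ ∩ y^⊥}`. -/
def doublePerp (x y : P) : Set P :=
  {z | ∀ u ∈ S.perpSet x ∩ S.perpSet y, S.Perp z u}

/-- A subspace: every line meeting it in at least two points is contained in it. -/
def IsSubspace (X : Set P) : Prop :=
  ∀ l ∈ S.L, (∃ x ∈ l ∩ X, ∃ y ∈ l ∩ X, x ≠ y) → l ⊆ X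

/-- `⟨Y⟩`, the subspace generated by `Y`. -/
def span (Y : Set P) : Set P := ⋂₀ {X | S.IsSubspace X ∧ Y ⊆ X}

/-- A plane: the subspace generated by two distinct lines meeting in a point. -/
def IsPlane (X : Set P) : Prop :=
  ∃ l ∈ S.L, ∃ m ∈ S.L, l ≠ m ∧ (l ∩ m).Nonempty ∧ X = S.span (l ∪ m)

/-- A transversal plane: a plane `X` such that for every line `ℓ ⊆ X` the sets
`x^⊥ ∩ X`, for `x ∈ ℓ`, partition `X` (every point of `X` lies in exactly one
of them). -/
def IsTransversalPlane (X : Set P) : Prop :=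
  S.IsPlane X ∧ ∀ l ∈ S.L, l ⊆ X → ∀ p ∈ X, ∃! x, x ∈ l ∧ S.Perp x p

/-- `T` is a transversal of `X`: `T = x^⊥ ∩ X` for a point `x` on a line of `X`. -/
def IsTransversalOf (T X : Set P) : Prop :=
  ∃ l ∈ S.L, l ⊆ X ∧ ∃ x ∈ l, T = S.perpSet x ∩ X

/-- Connectedness of the collinearity graph `(P, ∼)`. -/
def Connected : Prop := ∀ x y : P, Relation.ReflTransGen S.Collinear x y

/-- Connectedness of the graph `(P, ⊥)`. -/
def CoConnected : Prop := ∀ x y : P, Relation.ReflTransGen S.PerpAdj x y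

/-- The one-or-all axiom for polar spaces. -/
def IsPolar : Prop :=
  ∀ p : P, ∀ l ∈ S.L, p ∉ l →
    (∃! q, q ∈ l ∧ S.Collinear p q) ∨ (∀ q ∈ l, S.Collinear p q)

/-- Non-degeneracy: the radical is empty, i.e. no point is collinear with all
other points. -/
def Nondegenerate : Prop := ∀ p : P, ∃ q, q ≠ p ∧ ¬ S.Collinear p q

/-- In a polar space, `p^⊥` denotes the points equal or collinear to `p`. -/
def polarPerp (x : P) : Set P := {q | q = x ∨ S.Collinear x q}

/-- `X^⊥` in a polar space, for a set of points `X`. -/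
def polarPerpSet (X : Set P) : Set P := {q | ∀ x ∈ X, q ∈ S.polarPerp x}

/-- The hyperbolic line on two non-collinear points of a polar space:
`{z : z ∈ u^⊥ for every u ∈ x^⊥ ∩ y^⊥}`. -/
def polarHypLine (x y : P) : Set P :=
  {z | ∀ u ∈ S.polarPerp x ∩ S.polarPerp y, z ∈ S.polarPerp u}

/-- A linear set: any two of its distinct points are collinear. -/
def IsLinearSet (X : Set P) : Prop := ∀ x ∈ X, ∀ y ∈ X, x ≠ y → S.Collinear x y

/-- Planarity: any two distinct lines meeting in a point are contained in a
unique plane. -/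
def Planar : Prop :=
  ∀ l ∈ S.L, ∀ m ∈ S.L, l ≠ m → (l ∩ m).Nonempty →
    ∃! π, S.IsPlane π ∧ l ⊆ π ∧ m ⊆ π

/-- A projective plane: a linear space in which any two distinct lines meet in
a point, containing four points no three of which are collinear. -/
def IsProjectivePlane : Prop :=
  (∀ x y : P, x ≠ y → ∃ l ∈ S.L, x ∈ l ∧ y ∈ l) ∧
  (∀ l ∈ S.L, ∀ m ∈ S.L, l ≠ m → (l ∩ m).Nonempty) ∧
  (∃ a b c d : P, a ≠ b ∧ a ≠ c ∧ a ≠ d ∧ b ≠ c ∧ b ≠ d ∧ c ≠ d ∧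
    ∀ l ∈ S.L, ¬(a ∈ l ∧ b ∈ l ∧ c ∈ l) ∧ ¬(a ∈ l ∧ b ∈ l ∧ d ∈ l) ∧
      ¬(a ∈ l ∧ c ∈ l ∧ d ∈ l) ∧ ¬(b ∈ l ∧ c ∈ l ∧ d ∈ l))

/-- `π` is isomorphic to a dual affine plane: there is a projective plane `T`
on a point set `Q`, a point `p` of `T`, and a bijection from `π` onto `Q ∖ {p}`
under which the lines of `Π` contained in `π` correspond exactly to the lines
of `T` not passing through `p`. -/
def IsDualAffine (π : Set P) : Prop :=
  ∃ (Q : Type u) (T : PLS Q) (p : Q) (f : P → Q),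
    T.IsProjectivePlane ∧ Set.BijOn f π {q | q ≠ p} ∧
    ∀ s : Set P, s ⊆ π → (s ∈ S.L ↔ f '' s ∈ T.L ∧ p ∉ f '' s)

/-- A linear plane contains four distinct lines which pairwise meet and whose
pairwise intersection points are six distinct points. -/
def FourLinesSixPoints (π : Set P) : Prop :=
  ∃ l : Fin 4 → Set P, (∀ i, l i ∈ S.L ∧ l i ⊆ π) ∧ Function.Injective l ∧
    ∃ pt : Fin 4 → Fin 4 → P,
      (∀ i j, i < j → pt i j ∈ l i ∩ l j) ∧
      (∀ i j k m, i < j → k < m → (i, j) ≠ (k, m) → pt i j ≠ pt k m)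

/-- Conditions (a)–(d) of the Main Hypothesis, for a connected and co-connected
partial linear space:
(a) all lines have at least `4` points;
(b) `x^⊥ ⊆ y^⊥` implies `x = y`;
(c) every triple `x ∼ y ∼ z`, `x ⊥ z`, `x ≠ z`, generates a transversal plane;
(d) for every point `p` and transversal plane `π`, `p^⊥ ∩ π` is empty, a
point, a line, or a transversal of `π`. -/
def MainHyp : Prop :=
  S.Connected ∧ S.CoConnected ∧
  (∀ l ∈ S.L, 4 ≤ Cardinal.mk ↥l) ∧
  (∀ x y : P, S.perpSet x ⊆ S.perpSet y → x = y) ∧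
  (∀ x y z : P, S.Collinear x y → S.Collinear y z → S.PerpAdj x z →
    S.IsTransversalPlane (S.span {x, y, z})) ∧
  (∀ p : P, ∀ π : Set P, S.IsTransversalPlane π →
    S.perpSet p ∩ π = ∅ ∨ (∃ q, S.perpSet p ∩ π = {q}) ∨
    S.perpSet p ∩ π ∈ S.L ∨ S.IsTransversalOf (S.perpSet p ∩ π) π)

/-- Conditions (a)–(e) of the Setting, for a connected partial linear space:
(a) all lines have at least `4` points;
(b) `x^⊥ ⊆ y^⊥` implies `x^⊥ = y^⊥`;
(c) there exist two distinct non-collinear points;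
(d) every triple `x ∼ y ∼ z`, `x ⊥ z`, `x ≠ z`, is contained in a transversal
plane;
(e) for every point `p` and transversal plane `π`, `p^⊥ ∩ π` is empty, a
point, a line, a transversal of `π`, or `π` itself. -/
def Setting : Prop :=
  S.Connected ∧
  (∀ l ∈ S.L, 4 ≤ Cardinal.mk ↥l) ∧
  (∀ x y : P, S.perpSet x ⊆ S.perpSet y → S.perpSet x = S.perpSet y) ∧
  (∃ x y : P, x ≠ y ∧ ¬ S.Collinear x y) ∧
  (∀ x y z : P, S.Collinear x y → S.Collinear y z → S.PerpAdj x z →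
    ∃ π, S.IsTransversalPlane π ∧ x ∈ π ∧ y ∈ π ∧ z ∈ π) ∧
  (∀ p : P, ∀ π : Set P, S.IsTransversalPlane π →
    S.perpSet p ∩ π = ∅ ∨ (∃ q, S.perpSet p ∩ π = {q}) ∨
    S.perpSet p ∩ π ∈ S.L ∨ S.IsTransversalOf (S.perpSet p ∩ π) π ∨
    S.perpSet p ∩ π = π)

end PLS


namespace PLS

variable {P : Type u} {S : PLS P}

theorem col_symm' {x y : P} (h : S.Collinear x y) : S.Collinear y x := by
  obtain ⟨hn, l, hl, hx, hy⟩ := h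
  exact ⟨hn.symm, l, hl, hy, hx⟩

theorem perp_symm' {x y : P} (h : S.Perp x y) : S.Perp y x := fun h' => h (col_symm' h')

theorem perp_refl' (x : P) : S.Perp x x := fun h => h.1 rfl

theorem plane_sub {X : Set P} (h : S.IsPlane X) : S.IsSubspace X := by
  obtain ⟨l, _, m, _, _, _, rfl⟩ := h
  rintro n hn ⟨x, ⟨hxn, hx⟩, y, ⟨hyn, hy⟩, hxy⟩ z hz X hX
  exact hX.1 n hn ⟨x, ⟨hxn, hx X hX⟩, y, ⟨hyn, hy X hX⟩, hxy⟩ hz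

theorem line_in {X : Set P} (h : S.IsTransversalPlane X) {l : Set P} (hl : l ∈ S.L) {x y : P}
    (hxy : x ≠ y) (hx : x ∈ l) (hy : y ∈ l) (hxX : x ∈ X) (hyX : y ∈ X) : l ⊆ X :=
  plane_sub h.1 l hl ⟨x, ⟨hx, hxX⟩, y, ⟨hy, hyX⟩, hxy⟩

theorem third {l : Set P} (h4 : 4 ≤ Cardinal.mk ↥l) (x y : P) : ∃ z ∈ l, z ≠ x ∧ z ≠ y := by
  by_contra hc
  push Not at hc
  have hs : l ⊆ ({x, y} : Set P) := by
    intro z hz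
    by_cases h : z = x
    · simp [h]
    · simp [hc z hz h]
  have h1 : Cardinal.mk ↥l ≤ 2 :=
    (Cardinal.mk_le_mk_of_subset hs).trans (by
      refine (Cardinal.mk_insert_le).trans ?_
      rw [Cardinal.mk_singleton]
      norm_num)
  have h2 : (4 : Cardinal) ≤ 2 := h4.trans h1
  norm_num at h2

/-- transitivity of perp inside a transversal plane -/
theorem tp_trans {X : Set P} (h : S.IsTransversalPlane X) {w b c : P} (hw : w ∈ X) (hb : b ∈ X)
    (hc : c ∈ X) (h1 : S.Perp w b) (h2 : S.Perp b c) : S.Perp w c := by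
  rintro ⟨hne, l, hl, hwl, hcl⟩
  exact hne ((h.2 l hl (line_in h hl hne hwl hcl hw hc) b hb).unique ⟨hwl, h1⟩
    ⟨hcl, perp_symm' h2⟩)

/-- In a transversal plane on `x ∼ a`, `a ⊥ b`. -/
theorem exists_pt {X : Set P} (h : S.IsTransversalPlane X)
    (ha4 : ∀ l ∈ S.L, 4 ≤ Cardinal.mk ↥l) {x a b : P}
    (hx : x ∈ X) (ha : a ∈ X) (hb : b ∈ X) (hab : a ≠ b) (hp : S.Perp a b)
    {l : Set P} (hl : l ∈ S.L) (hxa : x ≠ a) (hxl : x ∈ l) (hal : a ∈ l) :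
    ∃ y ∈ l, y ≠ x ∧ y ≠ a ∧ y ≠ b ∧ ∃ m ∈ S.L, y ∈ m ∧ b ∈ m ∧ m ⊆ X ∧
      ∃ x1 ∈ m, S.Perp x x1 ∧ x1 ≠ x ∧ x1 ∈ X := by
  obtain ⟨y, hyl, hyx, hya⟩ := third (ha4 l hl) x a
  have hlX : l ⊆ X := line_in h hl hxa hxl hal hx ha
  have hyb : S.Collinear y b := by
    by_contra hc
    exact hya ((h.2 l hl hlX b hb).unique ⟨hyl, hc⟩ ⟨hal, hp⟩)
  obtain ⟨hyb, m, hm, hym, hbm⟩ := hyb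
  have hmX : m ⊆ X := line_in h hm hyb hym hbm (hlX hyl) hb
  obtain ⟨x1, ⟨hx1m, hx1⟩, _⟩ := h.2 m hm hmX x hx
  refine ⟨y, hyl, hyx, hya, hyb, m, hm, hym, hbm, hmX, x1, hx1m, perp_symm' hx1, ?_, hmX hx1m⟩
  rintro rfl
  have := S.unique_line m hm l hl x1 y hyx.symm hx1m hym hxl hyl
  subst this
  exact hp ⟨hab, m, hm, hal, hbm⟩

theorem key (h : S.Setting) {x : P}
    (hC : ∀ p q, S.Perp x p → S.Perp p q → S.Perp x q)
    (hCC : ∀ p q, S.Perp x p → S.Perp x q → S.Perp p q) {a b c : P}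
    (hab : S.Perp a b) (hbc : S.Perp b c) : S.Perp a c := by
  by_cases hxa : S.Perp x a
  · exact hCC a c hxa (hC b c (hC a b hxa hab) hbc)
  have hxb : ¬ S.Perp x b := fun hb => hxa (hC b a hb (perp_symm' hab))
  have hxc : ¬ S.Perp x c := fun hb => hxb (hC c b hb (perp_symm' hbc))
  intro hac
  have nab : a ≠ b := by rintro rfl; exact hbc hac
  have nbc : b ≠ c := by rintro rfl; exact hab hac
  obtain ⟨-, h4, -, -, hd, he⟩ := h
  have cxa := not_not.1 hxa
  have cxb := not_not.1 hxb
  have cxc := not_not.1 hxc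
  obtain ⟨π, hπ, haπ, hxπ, hbπ⟩ := hd a x b (col_symm' cxa) cxb ⟨nab, hab⟩
  obtain ⟨τ, hτ, hbτ, hxτ, hcτ⟩ := hd b x c (col_symm' cxb) cxc ⟨nbc, hbc⟩
  have hsing : ∀ z ∈ τ, S.Perp a z → z = b := by
    rcases he a τ hτ with h0 | ⟨q, hq⟩ | hline | htr | hall
    · exact (Set.eq_empty_iff_forall_notMem.1 h0 b ⟨hab, hbτ⟩).elim
    · intro z hz haz
      have h1 : z ∈ ({q} : Set P) := hq ▸ ⟨haz, hz⟩
      have h2 : b ∈ ({q} : Set P) := hq ▸ ⟨hab, hbτ⟩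
      exact h1.trans h2.symm
    · obtain ⟨z, ⟨hz, hzx⟩, _⟩ := hτ.2 _ hline Set.inter_subset_right x hxτ
      exact (hxa (hC z a (perp_symm' hzx) (perp_symm' hz.1))).elim
    · obtain ⟨l, hl, hlτ, w, hw, hT⟩ := htr
      have h1 : b ∈ S.perpSet w ∩ τ := hT ▸ ⟨hab, hbτ⟩
      have h2 : c ∈ S.perpSet w ∩ τ := ⟨tp_trans hτ (hlτ hw) hbτ hcτ h1.1 hbc, hcτ⟩
      rw [← hT] at h2
      exact (h2.1 hac).elim
    · have h2 : c ∈ S.perpSet a ∩ τ := hall.symm ▸ hcτ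
      exact (h2.1 hac).elim
  have haτ : a ∉ τ := fun h => nab (hsing a h (perp_refl' a))
  obtain ⟨nxa, l, hl, hxl, hal⟩ := cxa
  obtain ⟨y1, hy1l, hy1x, hy1a, hy1b, m1, hm1, hy1m1, hbm1, hm1π, x1, hx1m1, hxx1, nx1, hx1π⟩ :=
    exists_pt hπ h4 hxπ haπ hbπ nab hab hl nxa hxl hal
  have hy1τ : y1 ∉ τ := fun hy => haτ (line_in hτ hl hy1x.symm hxl hy1l hxτ hy hal)
  obtain ⟨nxb, k, hk, hxk, hbk⟩ := cxb
  obtain ⟨-, -, -, -, -, -, -, -, -, -, x2, -, hxx2, nx2, hx2τ⟩ :=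
    exists_pt hτ h4 hxτ hbτ hcτ nbc hbc hk nxb hxk hbk
  have cy1 : S.Collinear x y1 := ⟨hy1x.symm, l, hl, hxl, hy1l⟩
  have cx1b : S.Collinear x1 b := by
    by_contra hh; exact hxb (hC x1 b hxx1 hh)
  have cx2b : S.Collinear x2 b := by
    by_contra hh; exact hxb (hC x2 b hxx2 hh)
  obtain ⟨nx2b, m2, hm2, hx2m2, hbm2⟩ := id cx2b
  have hm2τ : m2 ⊆ τ := line_in hτ hm2 nx2b hx2m2 hbm2 hx2τ hbτ
  have n12 : x1 ≠ x2 := by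
    rintro rfl
    exact hy1τ (line_in hτ hm1 nx2b hx1m1 hbm1 hx2τ hbτ hy1m1)
  obtain ⟨ρ, hρ, hx1ρ, hbρ, hx2ρ⟩ := hd x1 b x2 cx1b (col_symm' cx2b) ⟨n12, hCC _ _ hxx1 hxx2⟩
  have hy1ρ : y1 ∈ ρ := line_in hρ hm1 cx1b.1 hx1m1 hbm1 hx1ρ hbρ hy1m1
  obtain ⟨y2, ⟨hy2m2, hy21⟩, -⟩ :=
    hρ.2 m2 hm2 (line_in hρ hm2 nx2b hx2m2 hbm2 hx2ρ hbρ) y1 hy1ρ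
  have hy2b : y2 ≠ b := by
    rintro rfl
    exact hy21 ⟨hy1b.symm, m1, hm1, hbm1, hy1m1⟩
  have hxy2 : S.Collinear x y2 := by
    by_contra hh
    exact hC y2 y1 hh hy21 cy1
  have hy2τ := hm2τ hy2m2
  have ny : y1 ≠ y2 := by rintro rfl; exact hy1τ hy2τ
  obtain ⟨θ, hθ, hy1θ, hxθ, hy2θ⟩ := hd y1 x y2 (col_symm' cy1) hxy2 ⟨ny, perp_symm' hy21⟩
  have haθ : a ∈ θ := line_in hθ hl hy1x.symm hxl hy1l hxθ hy1θ hal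
  obtain ⟨nxy2, n, hn, hxn, hy2n⟩ := hxy2
  obtain ⟨z, ⟨hzn, hza⟩, -⟩ := hθ.2 n hn (line_in hθ hn nxy2 hxn hy2n hxθ hy2θ) a haθ
  have hzb := hsing z (line_in hτ hn nxy2 hxn hy2n hxτ hy2τ hzn) (perp_symm' hza)
  subst hzb
  have := S.unique_line n hn m2 hm2 y2 z hy2b hy2n hzn hy2m2 hbm2
  subst this
  exact hxx2 ⟨nx2.symm, n, hn, hxn, hx2m2⟩

end PLS

/-- 3.10. In the Setting, if some connected component of
`(P, ⊥)` has diameter `1` (any two of its points are `⊥`), then every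
connected component of `(P, ⊥)` has diameter `1`. -/
theorem one_component_diameter_one {P : Type u} (S : PLS P) (h : S.Setting)
    (hone : ∃ x : P, ∀ a b : P, Relation.ReflTransGen S.PerpAdj x a →
      Relation.ReflTransGen S.PerpAdj x b → S.Perp a b) :
    ∀ x a b : P, Relation.ReflTransGen S.PerpAdj x a →
      Relation.ReflTransGen S.PerpAdj x b → S.Perp a b := by
  obtain ⟨x, hx⟩ := hone
  have step : ∀ p q, S.Perp p q → Relation.ReflTransGen S.PerpAdj p q := by
    intro p q hpq
    by_cases hh : p = q
    · rw [hh]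
    · exact Relation.ReflTransGen.single ⟨hh, hpq⟩
  have hCC : ∀ p q, S.Perp x p → S.Perp x q → S.Perp p q :=
    fun p q hp hq => hx p q (step _ _ hp) (step _ _ hq)
  have hC : ∀ p q, S.Perp x p → S.Perp p q → S.Perp x q :=
    fun p q hp hq => hx x q Relation.ReflTransGen.refl ((step _ _ hp).trans (step _ _ hq))
  have tr : ∀ p q, Relation.ReflTransGen S.PerpAdj p q → S.Perp p q := by
    intro p q hpq
    induction hpq with
    | refl => exact PLS.perp_refl' p
    | tail _ h2 ih => exact PLS.key h hC hCC ih h2.2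
  intro y a b ha hb
  exact PLS.key h hC hCC (PLS.perp_symm' (tr _ _ ha)) (tr _ _ hb)
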